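/- Let X be an n-correct set and let {A,B,C} ⊆ X be a special triplet with associated maximal curve f of degree n−1. Then A, B, C are not collinear, and A uses the line ℓ_{BC}, B uses ℓ_{CA}, and C uses ℓ_{AB}; in fact p*_A = c₁·ℓ_{BC}·f, p*_B = c₂·ℓ_{CA}·f, p*_C = c₃·ℓ_{AB}·f for nonzero constants c₁, c₂, c₃. -/

import Mathlib

open MvPolynomial Finset
open scoped Classical BigOperators

noncomputable section

/-- Points of the plane. -/
abbrev Pt : Type := Fin 2 → ℝ

/-- Bivariate real polynomials. -/
abbrev Poly2 : Type := MvPolynomial (Fin 2) ℝ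

/-- `N = dim Π_n = (n+1)(n+2)/2`. -/
def Nn (n : ℕ) : ℕ := (n + 1) * (n + 2) / 2

/-- `X` is an `n`-correct set of nodes: it has `N` nodes and the only polynomial of total
degree at most `n` vanishing at all of them is the zero polynomial. -/
def IsNCorrect (n : ℕ) (X : Finset Pt) : Prop :=
  X.card = Nn n ∧
  ∀ p : Poly2, p.totalDegree ≤ n → (∀ P ∈ X, eval P p = 0) → p = 0

/-- A line: a (nonzero) polynomial of total degree exactly 1. -/
def IsLine (ℓ : Poly2) : Prop := ℓ.totalDegree = 1

/-- The zero set of a polynomial, as a subset of the plane. -/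
def zeroSet (q : Poly2) : Set Pt := {P : Pt | eval P q = 0}

/-- `X ∩ q` : the nodes of `X` lying on the curve `q`. -/
def zerosIn (X : Finset Pt) (q : Poly2) : Finset Pt := X.filter fun P => eval P q = 0

/-- `X \ q` : the nodes of `X` not lying on the curve `q`. -/
def nonzerosIn (X : Finset Pt) (q : Poly2) : Finset Pt := X.filter fun P => eval P q ≠ 0

/-- `ℓ` is a maximal line for (an `n`-correct set) `X`: a line passing through
exactly `n+1` nodes. -/
def IsMaximalLine (n : ℕ) (X : Finset Pt) (ℓ : Poly2) : Prop :=
  IsLine ℓ ∧ (zerosIn X ℓ).card = n + 1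

/-- The collection of maximal lines of `X` (as subsets of the plane). -/
def maximalLines (n : ℕ) (X : Finset Pt) : Set (Set Pt) :=
  {Z : Set Pt | ∃ ℓ : Poly2, IsMaximalLine n X ℓ ∧ Z = zeroSet ℓ}

/-- `p` is the `n`-fundamental polynomial of the node `A` of `X`. -/
def IsFund (n : ℕ) (X : Finset Pt) (A : Pt) (p : Poly2) : Prop :=
  p.totalDegree ≤ n ∧ eval A p = 1 ∧ ∀ P ∈ X, P ≠ A → eval P p = 0

/-- The node `A` of `X` uses the curve `q`: `q` divides the fundamental polynomial of `A`. -/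
def Uses (n : ℕ) (X : Finset Pt) (A : Pt) (q : Poly2) : Prop :=
  ∃ p : Poly2, IsFund n X A p ∧ q ∣ p

/-- `d(n,k) = k(2n+3-k)/2`. -/
def d (n k : ℕ) : ℕ := k * (2 * n + 3 - k) / 2

/-- `q` is a maximal curve of degree `k` for `X`: it passes through exactly `d(n,k)` nodes. -/
def IsMaximalCurve (n k : ℕ) (X : Finset Pt) (q : Poly2) : Prop :=
  q.totalDegree = k ∧ (zerosIn X q).card = d n k

/-- `{A,B,C}` is a special triplet of the `n`-correct set `X` : there is a maximal curve `f`
of degree `n-1` with `X \ f = {A,B,C}`. -/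
def IsSpecialTriplet (n : ℕ) (X : Finset Pt) (A B C : Pt) : Prop :=
  A ∈ X ∧ B ∈ X ∧ C ∈ X ∧ A ≠ B ∧ A ≠ C ∧ B ≠ C ∧
  ∃ f : Poly2, IsMaximalCurve n (n - 1) X f ∧ nonzerosIn X f = {A, B, C}

/-- `X` is a `GC_n` set: an `n`-correct set in which every fundamental polynomial is a
product of `n` linear factors. -/
def IsGC (n : ℕ) (X : Finset Pt) : Prop :=
  IsNCorrect n X ∧
  ∀ A ∈ X, ∃ p : Poly2, IsFund n X A p ∧
    ∃ g : Fin n → Poly2, (∀ i, (g i).totalDegree = 1) ∧ p = ∏ i, g i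

/-- `ℓ` is a line passing through the points `P` and `Q` (in particular, `ℓ_{PQ}` when
`P ≠ Q`). -/
def IsLineThrough (ℓ : Poly2) (P Q : Pt) : Prop :=
  IsLine ℓ ∧ eval P ℓ = 0 ∧ eval Q ℓ = 0

/-- `ℓ` is a `2`-node line of `X` passing through exactly the two nodes `A` and `B`. -/
def IsTwoNodeLineOf (X : Finset Pt) (ℓ : Poly2) (A B : Pt) : Prop :=
  IsLine ℓ ∧ A ≠ B ∧ zerosIn X ℓ = {A, B}

/-- `Y` is an `n`-independent set: every point has an `n`-fundamental polynomial. -/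
def IsNIndependent (n : ℕ) (Y : Finset Pt) : Prop :=
  ∀ A ∈ Y, ∃ p : Poly2, p.totalDegree ≤ n ∧ eval A p ≠ 0 ∧
    ∀ P ∈ Y, P ≠ A → eval P p = 0

/-- A family of lines is in general position: no two parallel (or equal) — i.e. any two of
them meet in a unique point — and no three concurrent. -/
def GenPos {m : ℕ} (ℓ : Fin m → Poly2) : Prop :=
  (∀ i, IsLine (ℓ i)) ∧
  (∀ i j, i ≠ j → ∃! P : Pt, eval P (ℓ i) = 0 ∧ eval P (ℓ j) = 0) ∧
  (∀ i j k, i ≠ j → i ≠ k → j ≠ k →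
    ¬∃ P : Pt, eval P (ℓ i) = 0 ∧ eval P (ℓ j) = 0 ∧ eval P (ℓ k) = 0)

/-- `X` is a Chung–Yao set of degree `n`: the set of pairwise intersection points of `n+2`
lines in general position. -/
def IsChungYao (n : ℕ) (X : Finset Pt) : Prop :=
  ∃ ℓ : Fin (n + 2) → Poly2, GenPos ℓ ∧
    (↑X : Set Pt) = {P : Pt | ∃ i j, i ≠ j ∧ eval P (ℓ i) = 0 ∧ eval P (ℓ j) = 0}

/-- `X` is a Carnicer–Gasca set of degree `n`: the pairwise intersection points of `n+1`
lines in general position together with one extra point `A i` on each line `ℓ i`, the `A i`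
lying on no other line of the family and not all collinear. -/
def IsCarnicerGasca (n : ℕ) (X : Finset Pt) : Prop :=
  ∃ (ℓ : Fin (n + 1) → Poly2) (A : Fin (n + 1) → Pt), GenPos ℓ ∧
    (∀ i j, eval (A i) (ℓ j) = 0 ↔ j = i) ∧
    (¬∃ L : Poly2, IsLine L ∧ ∀ i, eval (A i) L = 0) ∧
    (↑X : Set Pt) =
      {P : Pt | ∃ i j, i ≠ j ∧ eval P (ℓ i) = 0 ∧ eval P (ℓ j) = 0} ∪ Set.range A

/-- In an `n`-correct set, a curve of degree at most `n` that vanishes at all nodes but `A` is,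
up to a nonzero scalar, the fundamental polynomial of `A`. -/
lemma IsNCorrect.fund_of_vanish {n : ℕ} {X : Finset Pt} (hX : IsNCorrect n X) {A : Pt}
    {q : Poly2} (hq : q ≠ 0) (hdeg : q.totalDegree ≤ n)
    (hvan : ∀ P ∈ X, P ≠ A → eval P q = 0) :
    eval A q ≠ 0 ∧ IsFund n X A ((eval A q)⁻¹ • q) ∧
      ∀ p : Poly2, IsFund n X A p → p = (eval A q)⁻¹ • q := by
  have hqA : eval A q ≠ 0 := fun h => hq <| hX.2 q hdeg fun P hP => by
    by_cases hPA : P = A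
    · rwa [hPA]
    · exact hvan P hP hPA
  refine ⟨hqA, ⟨(totalDegree_smul_le _ _).trans hdeg, ?_, fun P hP hPA => ?_⟩, ?_⟩
  · simp [smul_eval, hqA]
  · simp [smul_eval, hvan P hP hPA]
  · rintro p ⟨hpdeg, hpA, hp⟩
    refine sub_eq_zero.1 <| hX.2 _ ((totalDegree_sub _ _).trans
      (max_le hpdeg ((totalDegree_smul_le _ _).trans hdeg))) fun P hP => ?_
    by_cases hPA : P = A
    · subst hPA
      simp [smul_eval, hpA, hqA]
    · simp [smul_eval, hp P hP hPA, hvan P hP hPA]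

/-- If `f` has degree at most `n - 1` and misses exactly the nodes `A`, `B`, `C`, then the
line through `B` and `C` avoids `A` and, multiplied by `f`, gives the fundamental polynomial
of `A`. -/
lemma IsNCorrect.uses_line_of_nonzerosIn {n : ℕ} {X : Finset Pt} (hX : IsNCorrect n X)
    (hn : 1 ≤ n) {A B C : Pt} {f : Poly2} (hf : f.totalDegree ≤ n - 1)
    (hXf : nonzerosIn X f = {A, B, C}) {ℓ : Poly2} (hℓ : IsLineThrough ℓ B C) :
    eval A ℓ ≠ 0 ∧ Uses n X A ℓ ∧
      ∀ p : Poly2, IsFund n X A p → ∃ c : ℝ, c ≠ 0 ∧ p = c • (ℓ * f) := by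
  obtain ⟨hline, hB, hC⟩ := hℓ
  have hmem : ∀ P, (P ∈ X ∧ eval P f ≠ 0) ↔ P = A ∨ P = B ∨ P = C := fun P => by
    simpa [nonzerosIn] using Finset.ext_iff.1 hXf P
  have hf0 : f ≠ 0 := by
    rintro rfl
    simpa using ((hmem A).2 (Or.inl rfl)).2
  have hℓ0 : ℓ ≠ 0 := by
    rintro rfl
    simp [IsLine] at hline
  have hdeg : (ℓ * f).totalDegree ≤ n := by
    have hmul := totalDegree_mul ℓ f
    have hℓdeg : ℓ.totalDegree = 1 := hline
    omega
  have hvan : ∀ P ∈ X, P ≠ A → eval P (ℓ * f) = 0 := fun P hP hPA => by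
    rw [map_mul]
    by_cases hPf : eval P f = 0
    · rw [hPf, mul_zero]
    · rcases (hmem P).1 ⟨hP, hPf⟩ with h | rfl | rfl
      · exact absurd h hPA
      · rw [hB, zero_mul]
      · rw [hC, zero_mul]
  obtain ⟨hA, hfund, huniq⟩ := hX.fund_of_vanish (mul_ne_zero hℓ0 hf0) hdeg hvan
  refine ⟨fun h => hA (by rw [map_mul, h, zero_mul]),
    ⟨_, hfund, (Dvd.intro f rfl).trans (dvd_smul_of_dvd _ dvd_rfl)⟩,
    fun p hp => ⟨_, inv_ne_zero hA, huniq p hp⟩⟩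

/-- if `{A,B,C}` is a special triplet of the `n`-correct set `X` with
associated maximal curve `f` of degree `n-1`, then `A,B,C` are not collinear, `A` uses
`ℓ_{BC}`, `B` uses `ℓ_{CA}`, `C` uses `ℓ_{AB}`; in fact the fundamental polynomials are
nonzero constants times `ℓ_{BC}·f`, `ℓ_{CA}·f`, `ℓ_{AB}·f` respectively. -/
theorem special_triplet_uses_lines (n : ℕ) (X : Finset Pt) (hX : IsNCorrect n X)
    (A B C : Pt) (hA : A ∈ X) (hB : B ∈ X) (hC : C ∈ X)
    (hAB : A ≠ B) (hAC : A ≠ C) (hBC : B ≠ C)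
    (f : Poly2) (hf : IsMaximalCurve n (n - 1) X f)
    (hXf : nonzerosIn X f = {A, B, C}) :
    (¬∃ L : Poly2, IsLine L ∧ eval A L = 0 ∧ eval B L = 0 ∧ eval C L = 0) ∧
    (∀ ℓ : Poly2, IsLineThrough ℓ B C → Uses n X A ℓ ∧
      ∀ p : Poly2, IsFund n X A p → ∃ c : ℝ, c ≠ 0 ∧ p = c • (ℓ * f)) ∧
    (∀ ℓ : Poly2, IsLineThrough ℓ C A → Uses n X B ℓ ∧
      ∀ p : Poly2, IsFund n X B p → ∃ c : ℝ, c ≠ 0 ∧ p = c • (ℓ * f)) ∧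
    (∀ ℓ : Poly2, IsLineThrough ℓ A B → Uses n X C ℓ ∧
      ∀ p : Poly2, IsFund n X C p → ∃ c : ℝ, c ≠ 0 ∧ p = c • (ℓ * f)) := by
  have hn : 1 ≤ n := by
    have hcard : 1 < X.card := Finset.one_lt_card.2 ⟨A, hA, B, hB, hAB⟩
    rw [hX.1] at hcard
    rcases n with _ | n
    · simp [Nn] at hcard
    · omega
  have hdeg : f.totalDegree ≤ n - 1 := hf.1.le
  have hBCA : nonzerosIn X f = {B, C, A} := by
    rw [hXf]
    ext
    simp only [Finset.mem_insert, Finset.mem_singleton]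
    tauto
  have hCAB : nonzerosIn X f = {C, A, B} := by
    rw [hXf]
    ext
    simp only [Finset.mem_insert, Finset.mem_singleton]
    tauto
  refine ⟨?_, fun ℓ hℓ => (hX.uses_line_of_nonzerosIn hn hdeg hXf hℓ).2,
    fun ℓ hℓ => (hX.uses_line_of_nonzerosIn hn hdeg hBCA hℓ).2,
    fun ℓ hℓ => (hX.uses_line_of_nonzerosIn hn hdeg hCAB hℓ).2⟩
  rintro ⟨L, hL, hLA, hLB, hLC⟩
  exact (hX.uses_line_of_nonzerosIn hn hdeg hXf ⟨hL, hLB, hLC⟩).1 hLA
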